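/- arXiv:2012.05329 — 3 statements merged into one kernel-verified Lean document; each statement's English description precedes it below -/
import Mathlib

section
/- Let V ∈ ℝ^{C×D} have no zero entries and pairwise distinct entries in its d-th column, let a ∈ ℝ^C, and let x' ∈ ℝ^D with x'_d ≠ 0. Define g_c(x) = softmax(Vx + a)_c for each class c. Then for every class c, the Euclidean norm of the gradient of g_c evaluated at the scaled point x_α tends to 0 as α → ∞. -/
/-- The softmax function on `ℝ^C`. -/
noncomputable def softmax {C : ℕ} (z : Fin C → ℝ) : Fin C → ℝ :=
  fun c => Real.exp (z c) / ∑ c', Real.exp (z c')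

/-- The point `x'` scaled by `α` in coordinate `d` (all other coordinates unchanged). -/
def scaled {D : ℕ} (x' : Fin D → ℝ) (d : Fin D) (α : ℝ) : Fin D → ℝ :=
  Function.update x' d (α * x' d)

open Filter Topology

lemma sum_exp_pos {C : ℕ} (z : Fin C → ℝ) (c : Fin C) : 0 < ∑ k, Real.exp (z k) :=
  Finset.sum_pos (fun _ _ => Real.exp_pos _) ⟨c, Finset.mem_univ c⟩

lemma softmax_nonneg {C : ℕ} (z : Fin C → ℝ) (c : Fin C) : 0 ≤ softmax z c :=
  div_nonneg (Real.exp_pos _).le (sum_exp_pos z c).le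

lemma softmax_le_exp_sub {C : ℕ} (z : Fin C → ℝ) (c k : Fin C) :
    softmax z c ≤ Real.exp (z c - z k) := by
  rw [Real.exp_sub]
  exact div_le_div_of_nonneg_left (Real.exp_pos _).le (Real.exp_pos _)
    (Finset.single_le_sum (f := fun k => Real.exp (z k)) (fun _ _ => (Real.exp_pos _).le)
      (Finset.mem_univ k))

lemma softmax_le_one {C : ℕ} (z : Fin C → ℝ) (c : Fin C) : softmax z c ≤ 1 := by
  simpa using softmax_le_exp_sub z c c

lemma softmax_mul_le_exp_sub {C : ℕ} (z : Fin C → ℝ) (c k : Fin C) :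
    softmax z c * softmax z k ≤ Real.exp (z c - z k) :=
  (mul_le_of_le_one_right (softmax_nonneg z c) (softmax_le_one z k)).trans
    (softmax_le_exp_sub z c k)

lemma softmax_eq_inv {C : ℕ} (z : Fin C → ℝ) (c : Fin C) :
    softmax z c = (∑ k, Real.exp (z k - z c))⁻¹ := by
  simp only [softmax, Real.exp_sub, ← Finset.sum_div, inv_div]

lemma hasFDerivAt_softmax {E : Type*} [NormedAddCommGroup E] [NormedSpace ℝ E] {C : ℕ}
    {z : E → Fin C → ℝ} {l : Fin C → E →L[ℝ] ℝ} {x : E}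
    (hz : ∀ k, HasFDerivAt (fun y => z y k) (l k) x) (c : Fin C) :
    HasFDerivAt (fun y => softmax (z y) c)
      (∑ k, (softmax (z x) c * softmax (z x) k) • (l c - l k)) x := by
  have hsum : HasFDerivAt (fun y => ∑ k, Real.exp (z y k - z y c))
      (∑ k, Real.exp (z x k - z x c) • (l k - l c)) x :=
    HasFDerivAt.fun_sum fun k _ => ((hz k).sub (hz c)).exp
  have hne : ∑ k, Real.exp (z x k - z x c) ≠ 0 :=
    (sum_exp_pos (fun k => z x k - z x c) c).ne'
  have h := (hasDerivAt_inv hne).comp_hasFDerivAt x hsum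
  simp only [softmax_eq_inv (z _) c]
  refine h.congr_fderiv ?_
  rw [Finset.smul_sum]
  refine Finset.sum_congr rfl fun k _ => ?_
  rw [smul_smul, ← neg_sub (l c) (l k), smul_neg, ← neg_smul]
  congr 1
  have hS := (sum_exp_pos (z x) c).ne'
  have hc := (Real.exp_pos (z x c)).ne'
  simp only [softmax, Real.exp_sub, ← Finset.sum_div]
  field_simp

lemma tendsto_softmax_mul_of_sub {ι : Type*} {f : Filter ι} {C : ℕ} {z : ι → Fin C → ℝ}
    {c k : Fin C} (h : Tendsto (fun i => z i c - z i k) f atBot) :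
    Tendsto (fun i => softmax (z i) c * softmax (z i) k) f (𝓝 0) :=
  squeeze_zero (fun _ => mul_nonneg (softmax_nonneg _ _) (softmax_nonneg _ _))
    (fun i => softmax_mul_le_exp_sub (z i) c k) (Real.tendsto_exp_atBot.comp h)

lemma tendsto_softmax_mul_of_affine {C : ℕ} (u b : Fin C → ℝ) {c k : Fin C} (h : u c ≠ u k) :
    Tendsto (fun α : ℝ => softmax (α • u + b) c * softmax (α • u + b) k) atTop (𝓝 0) := by
  have key : ∀ i j : Fin C, u i < u j →
      Tendsto (fun α : ℝ => softmax (α • u + b) i * softmax (α • u + b) j) atTop (𝓝 0) := by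
    intro i j hij
    refine tendsto_softmax_mul_of_sub ?_
    have := tendsto_atBot_add_const_right atTop (b i - b j)
      (tendsto_id.atTop_mul_const_of_neg (sub_neg.2 hij))
    refine this.congr fun α => ?_
    simp only [id, Pi.add_apply, Pi.smul_apply, smul_eq_mul]
    ring
  rcases h.lt_or_gt with h | h
  · exact key c k h
  · simpa only [mul_comm] using key k c h

lemma mulVec_scaled {C D : ℕ} (V : Matrix (Fin C) (Fin D) ℝ) (x' : Fin D → ℝ) (d : Fin D)
    (α : ℝ) :
    V.mulVec (scaled x' d α) =
      α • (fun c => V c d * x' d) + V.mulVec (Function.update x' d 0) := by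
  have h : scaled x' d α = α • Pi.single d (x' d) + Function.update x' d 0 := by
    ext j
    by_cases hj : j = d
    · subst hj; simp [scaled]
    · simp [scaled, hj]
  rw [h, Matrix.mulVec_add, Matrix.mulVec_smul, Matrix.mulVec_single]
  congr 2

theorem stmt_2 (D C : ℕ) (hC : 1 ≤ C)
    (V : Matrix (Fin C) (Fin D) ℝ) (a : Fin C → ℝ) (d : Fin D)
    (hV : ∀ c d', V c d' ≠ 0)
    (hcol : Function.Injective fun c => V c d)
    (x' : Fin D → ℝ) (hx' : x' d ≠ 0) :
    ∀ c : Fin C,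
      Filter.Tendsto
        (fun α : ℝ =>
          ‖gradient
              (fun x : EuclideanSpace ℝ (Fin D) =>
                softmax (V.mulVec (WithLp.equiv 2 (Fin D → ℝ) x) + a) c)
              ((WithLp.equiv 2 (Fin D → ℝ)).symm (scaled x' d α))‖)
        Filter.atTop (nhds 0) := by
  intro c
  let l : Fin C → EuclideanSpace ℝ (Fin D) →L[ℝ] ℝ := fun k =>
    ∑ j, V k j • EuclideanSpace.proj j
  have hl : ∀ (k : Fin C) (x : EuclideanSpace ℝ (Fin D)),
      HasFDerivAt (fun y : EuclideanSpace ℝ (Fin D) =>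
        (V.mulVec (WithLp.equiv 2 (Fin D → ℝ) y) + a) k) (l k) x := by
    intro k x
    refine ((l k).hasFDerivAt.add_const (a k)).congr_of_eventuallyEq (.of_forall fun y => ?_)
    simp [l, Matrix.mulVec, dotProduct]
  let z : ℝ → Fin C → ℝ := fun α =>
    α • (fun k => V k d * x' d) + (V.mulVec (Function.update x' d 0) + a)
  have hz : ∀ α, V.mulVec (scaled x' d α) + a = z α := fun α => by
    rw [mulVec_scaled, add_assoc]
  simp only [gradient, LinearIsometryEquiv.norm_map,
    (hasFDerivAt_softmax (fun k => hl k _) c).fderiv, Equiv.apply_symm_apply, hz]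
  rw [← norm_zero (E := EuclideanSpace ℝ (Fin D) →L[ℝ] ℝ)]
  refine Tendsto.norm ?_
  rw [← Finset.sum_const_zero (s := (Finset.univ : Finset (Fin C)))]
  refine tendsto_finsetSum _ fun k _ => ?_
  rcases eq_or_ne c k with rfl | hck
  · simp
  · rw [← zero_smul ℝ (l c - l k)]
    refine (tendsto_softmax_mul_of_affine _ _ ?_).smul_const _
    exact fun h => hck (hcol (mul_right_cancel₀ hx' h))
end

section
/- Let K ≥ 1, and for each k ∈ {1,…,K} let V^{(k)} ∈ ℝ^{C×D} have no zero entries and pairwise distinct entries in its d-th column, and let a^{(k)} ∈ ℝ^C. Let x' ∈ ℝ^D with x'_d ≠ 0, and define the class-variance score u(x) = (1/C) Σ_{c=1}^{C} [ (1/K) Σ_{k=1}^{K} (softmax(V^{(k)} x + a^{(k)})_c)^2 − ( (1/K) Σ_{k=1}^{K} softmax(V^{(k)} x + a^{(k)})_c )^2 ]. Then the class-variance score converges to a fixed value: there exists L ∈ ℝ such that u(x_α) → L as α → ∞. -/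
open Filter Topology

lemma softmax_eq_inv_sum_exp_sub {C : ℕ} (z : Fin C → ℝ) (c : Fin C) :
    softmax z c = (∑ c', Real.exp (z c' - z c))⁻¹ := by
  simp only [softmax, Real.exp_sub]
  rw [← Finset.sum_div, inv_div]

/-- Along any ray in `ℝ^C`, each component of the softmax converges. -/
lemma exists_tendsto_softmax_ray {C : ℕ} (p q : Fin C → ℝ) (c : Fin C) :
    ∃ l : ℝ, Tendsto (fun α : ℝ => softmax (α • p + q) c) atTop (𝓝 l) := by
  have hexp (α : ℝ) (i : Fin C) :
      (α • p + q) i - (α • p + q) c = α * (p i - p c) + (q i - q c) := by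
    simp only [Pi.add_apply, Pi.smul_apply, smul_eq_mul]
    ring
  simp only [softmax_eq_inv_sum_exp_sub, hexp]
  by_cases h : ∃ i, p c < p i
  · obtain ⟨i, hi⟩ := h
    have hterm : Tendsto (fun α : ℝ => Real.exp (α * (p i - p c) + (q i - q c))) atTop atTop :=
      Real.tendsto_exp_atTop.comp <|
        tendsto_atTop_add_const_right _ _ (tendsto_id.atTop_mul_const (sub_pos.2 hi))
    refine ⟨0, (tendsto_atTop_mono (fun α => ?_) hterm).inv_tendsto_atTop⟩
    exact Finset.single_le_sum (f := fun j => Real.exp (α * (p j - p c) + (q j - q c)))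
      (fun j _ => (Real.exp_pos _).le) (Finset.mem_univ i)
  · push Not at h
    have hterm (i : Fin C) : ∃ l : ℝ, 0 ≤ l ∧ (i = c → 0 < l) ∧
        Tendsto (fun α : ℝ => Real.exp (α * (p i - p c) + (q i - q c))) atTop (𝓝 l) := by
      rcases (h i).eq_or_lt with hi | hi
      · refine ⟨Real.exp (q i - q c), (Real.exp_pos _).le, fun _ => Real.exp_pos _, ?_⟩
        simp [hi]
      · refine ⟨0, le_rfl, fun hic => absurd hi (by simp [hic]), ?_⟩
        exact Real.tendsto_exp_atBot.comp <|
          tendsto_atBot_add_const_right _ _ (tendsto_id.atTop_mul_const_of_neg (sub_neg.2 hi))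
    choose l hl hlc hlim using hterm
    refine ⟨(∑ i, l i)⁻¹, (tendsto_finsetSum _ fun i _ => hlim i).inv₀ ?_⟩
    exact (Finset.sum_pos' (fun i _ => hl i) ⟨c, Finset.mem_univ c, hlc c rfl⟩).ne'

lemma scaled_eq_smul_single_add {D : ℕ} (x : Fin D → ℝ) (d : Fin D) (α : ℝ) :
    scaled x d α = α • Pi.single d (x d) + Function.update x d 0 := by
  ext i
  by_cases h : i = d
  · subst h
    simp [scaled]
  · simp [scaled, h]

lemma exists_tendsto_softmax_scaled {C D : ℕ} (V : Matrix (Fin C) (Fin D) ℝ) (a : Fin C → ℝ)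
    (x : Fin D → ℝ) (d : Fin D) (c : Fin C) :
    ∃ l : ℝ, Tendsto (fun α : ℝ => softmax (V.mulVec (scaled x d α) + a) c) atTop (𝓝 l) := by
  simpa only [scaled_eq_smul_single_add, Matrix.mulVec_add, Matrix.mulVec_smul, add_assoc] using
    exists_tendsto_softmax_ray (V.mulVec (Pi.single d (x d)))
      (V.mulVec (Function.update x d 0) + a) c

theorem stmt_10 (D C K : ℕ) (hC : 1 ≤ C) (hK : 1 ≤ K)
    (V : Fin K → Matrix (Fin C) (Fin D) ℝ) (a : Fin K → Fin C → ℝ) (d : Fin D)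
    (hV : ∀ k c d', V k c d' ≠ 0)
    (hcol : ∀ k, Function.Injective fun c => V k c d)
    (x' : Fin D → ℝ) (hx' : x' d ≠ 0) :
    ∃ L : ℝ,
      Filter.Tendsto
        (fun α : ℝ =>
          (1 / (C : ℝ)) *
            ∑ c : Fin C,
              ((1 / (K : ℝ)) *
                  ∑ k : Fin K, (softmax ((V k).mulVec (scaled x' d α) + a k) c) ^ 2 -
                ((1 / (K : ℝ)) *
                    ∑ k : Fin K, softmax ((V k).mulVec (scaled x' d α) + a k) c) ^ 2))
        Filter.atTop (nhds L) := by
  choose l hl using fun k c => exists_tendsto_softmax_scaled (V k) (a k) x' d c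
  exact ⟨_, (tendsto_finsetSum _ fun c _ =>
    ((tendsto_finsetSum _ fun k _ => (hl k c).pow 2).const_mul _).sub
      (((tendsto_finsetSum _ fun k _ => hl k c).const_mul _).pow 2)).const_mul _⟩
end

section
/- Let K ≥ 1, and for each k ∈ {1,…,K} let V^{(k)} ∈ ℝ^{C×D} have no zero entries and pairwise distinct entries in its d-th column, and let a^{(k)} ∈ ℝ^C. Let x' ∈ ℝ^D with x'_d ≠ 0, let p̄_c(x) = (1/K) Σ_{k=1}^{K} softmax(V^{(k)} x + a^{(k)})_c, and define the approximate mutual information I(x) = H(p̄(x)) − (1/K) Σ_{k=1}^{K} H(softmax(V^{(k)} x + a^{(k)})), where H(p) = −Σ_{c=1}^{C} p_c log p_c. Then the approximate mutual information converges to a fixed value: there exists L ∈ ℝ such that I(x_α) → L as α → ∞. -/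
/-- Shannon entropy of a vector of probabilities. -/
noncomputable def shannonEntropy {C : ℕ} (p : Fin C → ℝ) : ℝ :=
  -∑ c : Fin C, p c * Real.log (p c)

/-- The averaged predictive distribution of `K` softmax-affine model instances. -/
noncomputable def avgPred {D C K : ℕ} (V : Fin K → Matrix (Fin C) (Fin D) ℝ)
    (a : Fin K → Fin C → ℝ) (x : Fin D → ℝ) (c : Fin C) : ℝ :=
  (1 / (K : ℝ)) * ∑ k : Fin K, softmax ((V k).mulVec x + a k) c

theorem mulVec_scaled_apply {C D : ℕ} (M : Matrix (Fin C) (Fin D) ℝ) (x' : Fin D → ℝ) (d : Fin D)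
    (α : ℝ) (c : Fin C) :
    M.mulVec (scaled x' d α) c =
      α * (M c d * x' d) + M.mulVec (Function.update x' d 0) c := by
  have h : scaled x' d α = Pi.single d (α * x' d) + Function.update x' d 0 := by
    ext i
    rcases eq_or_ne i d with rfl | hi <;> simp [scaled, *]
  rw [h, Matrix.mulVec_add, Pi.add_apply, Matrix.mulVec_single]
  simp
  ring

theorem softmax_add_const {C : ℕ} (z : Fin C → ℝ) (t : ℝ) :
    softmax (fun c => z c + t) = softmax z := by
  ext c
  simp only [softmax, Real.exp_add, ← Finset.sum_mul]
  exact mul_div_mul_right _ _ (Real.exp_ne_zero t)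

theorem exists_tendsto_exp_mul_add {m : ℝ} (hm : m ≤ 0) (b : ℝ) :
    ∃ l : ℝ, Filter.Tendsto (fun α : ℝ => Real.exp (α * m + b)) Filter.atTop (nhds l) := by
  rcases hm.eq_or_lt with rfl | hm
  · exact ⟨Real.exp b, by simp⟩
  · exact ⟨0, Real.tendsto_exp_atBot.comp
      (Filter.tendsto_atBot_add_const_right _ _ (Filter.tendsto_id.atTop_mul_const_of_neg hm))⟩

/-- Along a ray of logits, the softmax converges. -/
theorem exists_tendsto_softmax_ray_s12 {C : ℕ} (m b : Fin C → ℝ) :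
    ∃ p : Fin C → ℝ, ∀ c,
      Filter.Tendsto (fun α : ℝ => softmax (fun i => α * m i + b i) c) Filter.atTop
        (nhds (p c)) := by
  rcases isEmpty_or_nonempty (Fin C) with hC | hC
  · exact ⟨0, fun c => hC.elim c⟩
  obtain ⟨j, hj⟩ := Finite.exists_max m
  choose l hl using fun i => exists_tendsto_exp_mul_add (sub_nonpos.2 (hj i)) (b i)
  have hnonneg : ∀ i, 0 ≤ l i := fun i =>
    ge_of_tendsto' (hl i) fun α => (Real.exp_pos _).le
  have hlj : l j = Real.exp (b j) :=
    tendsto_nhds_unique (hl j) (by simp)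
  have hsum : 0 < ∑ i, l i :=
    Finset.sum_pos' (fun i _ => hnonneg i) ⟨j, Finset.mem_univ j, hlj ▸ Real.exp_pos _⟩
  refine ⟨fun c => l c / ∑ i, l i, fun c => ?_⟩
  have hden : Filter.Tendsto (fun α : ℝ => ∑ i, Real.exp (α * (m i - m j) + b i)) Filter.atTop
      (nhds (∑ i, l i)) := tendsto_finsetSum _ fun i _ => hl i
  refine ((hl c).div hden hsum.ne').congr fun α => ?_
  rw [← softmax_add_const _ (-(α * m j))]
  have hshift : ∀ i, α * (m i - m j) + b i = α * m i + b i + -(α * m j) := fun i => by ring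
  simp only [softmax, Pi.div_apply, hshift]

theorem tendsto_shannonEntropy {C : ℕ} {f : ℝ → Fin C → ℝ} {p : Fin C → ℝ} {l : Filter ℝ}
    (h : ∀ c, Filter.Tendsto (fun α => f α c) l (nhds (p c))) :
    Filter.Tendsto (fun α => shannonEntropy (f α)) l (nhds (shannonEntropy p)) :=
  (tendsto_finsetSum _ fun c _ =>
    (Real.continuous_mul_log.tendsto (p c)).comp (h c)).neg

theorem stmt_12 (D C K : ℕ) (hC : 1 ≤ C) (hK : 1 ≤ K)
    (V : Fin K → Matrix (Fin C) (Fin D) ℝ) (a : Fin K → Fin C → ℝ) (d : Fin D)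
    (hV : ∀ k c d', V k c d' ≠ 0)
    (hcol : ∀ k, Function.Injective fun c => V k c d)
    (x' : Fin D → ℝ) (hx' : x' d ≠ 0) :
    ∃ L : ℝ,
      Filter.Tendsto
        (fun α : ℝ =>
          shannonEntropy (avgPred V a (scaled x' d α)) -
            (1 / (K : ℝ)) *
              ∑ k : Fin K, shannonEntropy (softmax ((V k).mulVec (scaled x' d α) + a k)))
        Filter.atTop (nhds L) := by
  have hray : ∀ k, ∃ p : Fin C → ℝ, ∀ c,
      Filter.Tendsto (fun α : ℝ => softmax ((V k).mulVec (scaled x' d α) + a k) c)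
        Filter.atTop (nhds (p c)) := fun k => by
    obtain ⟨p, hp⟩ := exists_tendsto_softmax_ray_s12 (fun c => V k c d * x' d)
      ((V k).mulVec (Function.update x' d 0) + a k)
    refine ⟨p, fun c => (hp c).congr fun α => ?_⟩
    refine congrArg (softmax · c) (funext fun i => ?_)
    simp only [Pi.add_apply, mulVec_scaled_apply, add_assoc]
  choose p hp using hray
  exact ⟨_, (tendsto_shannonEntropy fun c =>
      (tendsto_finsetSum Finset.univ fun k _ => hp k c).const_mul (1 / (K : ℝ))).sub
    ((tendsto_finsetSum Finset.univ fun k _ => tendsto_shannonEntropy (hp k)).const_mul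
      (1 / (K : ℝ)))⟩
end
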